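/- arXiv:2305.19186 — 2 statements merged into one kernel-verified Lean document; each statement's English description precedes it below -/
import Mathlib

section
/- (Alon) t_s(n,2) = n^{(4+o(1))n}; precisely, for every ε > 0 there exists N such that for all n ≥ N one has n^{(4−ε)n} ≤ t_s(n,2) ≤ n^{(4+ε)n}. -/
noncomputable section

/-- The Euclidean plane. -/
abbrev Plane := EuclideanSpace ℝ (Fin 2)

/-- `π` is a straight-line embedding of the simple graph `G` in the plane:
it is injective, the closed segments of two distinct edges meet only in images of
common endpoints, and no vertex image lies in the open segment of a non-incident edge. -/
def IsSLEmbedding {V : Type*} (G : SimpleGraph V) (π : V → Plane) : Prop :=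
  Function.Injective π ∧
  (∀ u v x y : V, G.Adj u v → G.Adj x y → s(u, v) ≠ s(x, y) →
    segment ℝ (π u) (π v) ∩ segment ℝ (π x) (π y) ⊆ π '' (({u, v} : Set V) ∩ ({x, y} : Set V))) ∧
  (∀ u v w : V, G.Adj u v → w ≠ u → w ≠ v → π w ∉ openSegment ℝ (π u) (π v))

/-- `G` embeds straight-line on the point set `P`. -/
def EmbedsOn {V : Type*} (G : SimpleGraph V) (P : Set Plane) : Prop :=
  ∃ π : V → Plane, IsSLEmbedding G π ∧ Set.range π = P

/-- `G` embeds straight-line on some point set (equivalently, `G` is planar). -/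
def PlanarEmbeddable {V : Type*} (G : SimpleGraph V) : Prop :=
  ∃ π : V → Plane, IsSLEmbedding G π

/-- A family of graphs on `n` vertices is simultaneously embeddable if there is a point
set of size `n` on which every member embeds straight-line. -/
def SimultaneouslyEmbeddable {n : ℕ} (𝒢 : Set (SimpleGraph (Fin n))) : Prop :=
  ∃ P : Finset Plane, P.card = n ∧ ∀ G ∈ 𝒢, EmbedsOn G ↑P

/-- A conflict collection: a family of planar-embeddable graphs on `n` vertices that is
not simultaneously embeddable. -/
def ConflictCollection {n : ℕ} (𝒢 : Set (SimpleGraph (Fin n))) : Prop :=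
  (∀ G ∈ 𝒢, PlanarEmbeddable G) ∧ ¬ SimultaneouslyEmbeddable 𝒢

/-- The orientation of an ordered triple of points in the plane: the sign of the
determinant of [[1,1,1],[a₁,b₁,c₁],[a₂,b₂,c₂]]. -/
def orient (a b c : Plane) : ℝ :=
  Real.sign (Matrix.det !![(1 : ℝ), 1, 1; a 0, b 0, c 0; a 1, b 1, c 1])

/-- A labelled point tuple is in general position if every triple of points with
distinct indices has nonzero orientation. -/
def GenPos {n : ℕ} (p : Fin n → Plane) : Prop :=
  ∀ i j k : Fin n, i ≠ j → i ≠ k → j ≠ k → orient (p i) (p j) (p k) ≠ 0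

/-- Two labelled point tuples are isomorphic (have the same labelled order type) if
all increasing index triples have the same orientation. -/
def OTIso {n : ℕ} (p q : Fin n → Plane) : Prop :=
  ∀ i j k : Fin n, i < j → j < k → orient (p i) (p j) (p k) = orient (q i) (q j) (q k)

/-- Labelled `n`-point sets in general position. -/
def GPTuple (n : ℕ) := {p : Fin n → Plane // Function.Injective p ∧ GenPos p}

/-- `tS n` is the number `t_s(n,2)` of simple labelled order types: the number of
isomorphism classes of labelled `n`-point sets in general position. -/
def tS (n : ℕ) : ℕ := Nat.card (Quot fun p q : GPTuple n => OTIso p.1 q.1)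

section

open MvPolynomial Filter Topology
open scoped Matrix

namespace MvPolynomial

section Degree

variable {σ τ R : Type*} [CommSemiring R]

theorem totalDegree_pderiv_le (i : σ) (p : MvPolynomial σ R) :
    (pderiv i p).totalDegree ≤ p.totalDegree := by
  classical
  conv_lhs => rw [p.as_sum, map_sum]
  refine totalDegree_finsetSum_le fun s hs => ?_
  rw [pderiv_monomial]
  refine (totalDegree_monomial_le _ _).trans ((Finsupp.degree_mono tsub_le_self).trans ?_)
  exact le_totalDegree hs

theorem totalDegree_aeval_le {F : τ → MvPolynomial σ R} {D : ℕ}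
    (hF : ∀ j, (F j).totalDegree ≤ D) (c : MvPolynomial τ R) :
    (aeval F c).totalDegree ≤ D * c.totalDegree := by
  rw [aeval_def, eval₂_eq]
  refine totalDegree_finsetSum_le fun s hs => ?_
  rw [algebraMap_eq]
  refine (totalDegree_mul _ _).trans ?_
  rw [totalDegree_C, zero_add]
  refine (totalDegree_finsetProd _ _).trans ?_
  refine (Finset.sum_le_sum fun i _ => (totalDegree_pow _ _).trans
    (Nat.mul_le_mul_left _ (hF i))).trans ?_
  rw [← Finset.sum_mul, mul_comm]
  exact Nat.mul_le_mul_left _ (le_totalDegree hs)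

theorem finrank_restrictTotalDegree {σ K : Type*} [Fintype σ] [Field K] (s : ℕ) :
    Module.finrank K (restrictTotalDegree σ K s) = (s + Fintype.card σ).choose (Fintype.card σ) := by
  classical
  let B : Finset (σ →₀ ℕ) := (Finset.range (s + 1)).biUnion fun t => Finset.univ.finsuppAntidiag t
  have hB : { n : σ →₀ ℕ | (n.sum fun _ e => e) ≤ s } = B := by
    ext n
    simp [B, Finsupp.sum_fintype]
  have hcard : ∀ s : ℕ, ∑ t ∈ Finset.range (s + 1), (Fintype.card σ).multichoose t =
      (Fintype.card σ + 1).multichoose s := by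
    intro s
    induction s with
    | zero => simp
    | succ s ih => rw [Finset.sum_range_succ, ih, Nat.multichoose_succ_succ, add_comm]
  have e := Module.finrank_eq_nat_card_basis
    (basisRestrictSupport K { n : σ →₀ ℕ | (n.sum fun _ e => e) ≤ s })
  refine e.trans ?_
  rw [hB, Nat.card_coe_set_eq, Set.ncard_coe_finset, Finset.card_biUnion]
  · simp only [Finset.card_finsuppAntidiag_nat_eq_multichoose, Finset.card_univ]
    rw [hcard, Nat.multichoose_eq]
    have : Fintype.card σ + 1 + s - 1 = s + Fintype.card σ := by omega
    rw [this, ← Nat.choose_symm_add]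
  · intro a _ b _ hab
    rw [Function.onFun, Finset.disjoint_left]
    intro n hn hn'
    simp only [Finset.mem_finsuppAntidiag] at hn hn'
    exact hab (hn.1.symm.trans hn'.1)

end Degree

section Calculus

variable {σ : Type*} [Fintype σ]

theorem hasStrictFDerivAt_eval (p : MvPolynomial σ ℝ) (x : σ → ℝ) :
    HasStrictFDerivAt (fun y : σ → ℝ => eval y p)
      (∑ i, eval x (pderiv i p) • (ContinuousLinearMap.proj i : (σ → ℝ) →L[ℝ] ℝ)) x := by
  classical
  induction p using MvPolynomial.induction_on with
  | C a => simpa using hasStrictFDerivAt_const a x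
  | add p q hp hq =>
    simp only [map_add, add_smul, Finset.sum_add_distrib]
    exact hp.add hq
  | mul_X p j hp =>
    have h := hp.mul (ContinuousLinearMap.proj j : (σ → ℝ) →L[ℝ] ℝ).hasStrictFDerivAt
    simp only [map_mul, eval_X]
    refine h.congr_fderiv ?_
    ext v
    have hX : ∀ i, eval x ((Pi.single i 1 : σ → MvPolynomial σ ℝ) j) = if i = j then 1 else 0 := by
      intro i
      by_cases hij : i = j
      · subst hij; simp
      · simp [hij]
    simp [Derivation.leibniz, hX, add_mul, Finset.sum_add_distrib, Finset.mul_sum, mul_assoc]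

theorem hasStrictFDerivAt_pi_eval {ι : Type*} [Fintype ι] (F : ι → MvPolynomial σ ℝ) (x : σ → ℝ) :
    HasStrictFDerivAt (fun (y : σ → ℝ) j => eval y (F j))
      (fderiv ℝ (fun (y : σ → ℝ) j => eval y (F j)) x) x := by
  have h := hasStrictFDerivAt_pi.2 fun j => hasStrictFDerivAt_eval (F j) x
  rwa [h.hasFDerivAt.fderiv]

/-- Critical values of a polynomial self-map of affine space are negligible. -/
theorem ae_det_fderiv_ne_zero (F : σ → MvPolynomial σ ℝ) :
    ∀ᵐ q : σ → ℝ, ∀ x : σ → ℝ, (∀ j, eval x (F j) = q j) →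
      (fderiv ℝ (fun (y : σ → ℝ) j => eval y (F j)) x).det ≠ 0 := by
  set Φ : (σ → ℝ) → σ → ℝ := fun y j => eval y (F j) with hΦ
  have h := MeasureTheory.addHaar_image_eq_zero_of_det_fderivWithin_eq_zero
    (MeasureTheory.volume : MeasureTheory.Measure (σ → ℝ)) (f := Φ)
    (s := {x | (fderiv ℝ Φ x).det = 0}) (f' := fderiv ℝ Φ)
    (fun x _ => (hasStrictFDerivAt_pi_eval F x).hasFDerivAt.hasFDerivWithinAt) (fun x hx => hx)
  filter_upwards [MeasureTheory.measure_eq_zero_iff_ae_notMem.1 h] with q hq x hx h0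
  exact hq ⟨x, h0, _root_.funext hx⟩

theorem exists_eval_eq_ite [DecidableEq (σ → ℝ)] (S : Finset (σ → ℝ)) (z : σ → ℝ) :
    ∃ g : MvPolynomial σ ℝ, ∀ w ∈ S, eval w g = if w = z then 1 else 0 := by
  classical
  let r : (σ → ℝ) → MvPolynomial σ ℝ := fun w => ∑ j, (X j - C (w j)) ^ 2
  have hr : ∀ w v, eval v (r w) = 0 ↔ v = w := by
    intro w v
    simp only [r, map_sum, map_pow, map_sub, eval_X, eval_C]
    rw [Finset.sum_eq_zero_iff_of_nonneg fun _ _ => sq_nonneg _]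
    simp [_root_.funext_iff, sub_eq_zero]
  refine ⟨C (eval z (∏ w ∈ S.erase z, r w))⁻¹ * ∏ w ∈ S.erase z, r w, fun w hw => ?_⟩
  have hz : eval z (∏ w ∈ S.erase z, r w) ≠ 0 := by
    rw [map_prod, Finset.prod_ne_zero_iff]
    intro w hw h
    exact Finset.ne_of_mem_erase hw ((hr _ _).1 h).symm
  rw [map_mul, eval_C]
  split_ifs with h
  · rw [h, inv_mul_cancel₀ hz]
  · have h0 : eval w (∏ w ∈ S.erase z, r w) = 0 := by
      rw [map_prod]
      exact Finset.prod_eq_zero (Finset.mem_erase.2 ⟨h, hw⟩) ((hr w w).2 rfl)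
    rw [h0, mul_zero]

theorem eq_zero_of_eventually_eval_eq_zero {p : MvPolynomial σ ℝ} {q : σ → ℝ}
    (h : ∀ᶠ y in 𝓝 q, eval y p = 0) : p = 0 := by
  obtain ⟨ε, hε, hball⟩ := Metric.eventually_nhds_iff_ball.1 h
  refine funext_set (fun i => Metric.ball (q i) ε)
    (fun i => ?_) fun x hx => ?_
  · rw [Real.ball_eq_Ioo]
    exact Set.Ioo_infinite (by linarith)
  · rw [map_zero]
    refine hball x ?_
    rwa [ball_pi _ hε]

/-- A relation between separating polynomials at the nondegenerate points of a fibre of a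
polynomial map, with coefficients polynomial in that map, is trivial. -/
theorem injective_sum_aeval_mul (F : σ → MvPolynomial σ ℝ) (q : σ → ℝ) (S : Finset (σ → ℝ))
    (hS : ∀ x ∈ S, ∀ j, eval x (F j) = q j)
    (hdet : ∀ x ∈ S, (fderiv ℝ (fun (y : σ → ℝ) j => eval y (F j)) x).det ≠ 0)
    (g : S → MvPolynomial σ ℝ) (hg : ∀ z w : S, eval w (g z) = if w = z then 1 else 0)
    (c : S → MvPolynomial σ ℝ) (hc : ∑ z, aeval F (c z) * g z = 0) : c = 0 := by
  classical
  set Φ : (σ → ℝ) → σ → ℝ := fun y j => eval y (F j) with hΦ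
  have hinv : ∀ z : S, ∃ ψ : (σ → ℝ) → (σ → ℝ), Tendsto ψ (𝓝 q) (𝓝 (z : σ → ℝ)) ∧
      ∀ᶠ y in 𝓝 q, Φ (ψ y) = y := by
    intro z
    have hq : Φ z = q := _root_.funext (hS z z.2)
    have h := hasStrictFDerivAt_pi_eval F (z : σ → ℝ)
    rw [← ContinuousLinearMap.coe_toContinuousLinearEquivOfDetNeZero _ (hdet z z.2)] at h
    refine ⟨h.localInverse _ _ _, ?_, ?_⟩
    · simpa only [← hq] using h.localInverse_tendsto
    · simpa only [← hq] using h.eventually_right_inverse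
  choose ψ hψ hΦψ using hinv
  let B : (σ → ℝ) → Matrix S S ℝ := fun y => Matrix.of fun z w => eval (ψ z y) (g w)
  have hB : Tendsto B (𝓝 q) (𝓝 1) := by
    refine tendsto_pi_nhds.2 fun z => tendsto_pi_nhds.2 fun w => ?_
    have := ((continuous_eval (g w)).tendsto (z : σ → ℝ)).comp (hψ z)
    rwa [hg] at this
  have hBdet : ∀ᶠ y in 𝓝 q, (B y).det ≠ 0 := by
    have h1 : Tendsto (fun y => (B y).det) (𝓝 q) (𝓝 (1 : Matrix S S ℝ).det) :=
      (Continuous.matrix_det continuous_id).continuousAt.tendsto.comp hB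
    rw [Matrix.det_one] at h1
    exact h1.eventually_ne one_ne_zero
  have hzero : ∀ᶠ y in 𝓝 q, ∀ z, eval y (c z) = 0 := by
    filter_upwards [hBdet, eventually_all.2 hΦψ] with y hy hψy
    have hmul : B y *ᵥ (fun z => eval y (c z)) = 0 := by
      funext z
      have h := congrArg (eval (ψ z y)) hc
      rw [map_sum, map_zero] at h
      simp only [Matrix.mulVec, dotProduct, B, Matrix.of_apply, Pi.zero_apply]
      rw [← h]
      refine Finset.sum_congr rfl fun w _ => ?_
      rw [map_mul, mul_comm]
      congr 1
      have e : eval (ψ z y) (aeval F (c w)) = eval (Φ (ψ z y)) (c w) := by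
        have := comp_aeval_apply (f := F) (aeval (R := ℝ) (ψ z y)) (c w)
        simpa only [aeval_eq_eval] using this
      rw [e, hψy z]
    exact fun z => congrFun (Matrix.eq_zero_of_mulVec_eq_zero hy hmul) z
  funext z
  exact eq_zero_of_eventually_eval_eq_zero (hzero.mono fun y hy => hy z)

/-- A weak form of Bézout's theorem for nondegenerate real solutions. -/
theorem card_le_of_nondegenerate (F : σ → MvPolynomial σ ℝ) {D : ℕ}
    (hF : ∀ j, (F j).totalDegree ≤ D) (q : σ → ℝ) (S : Finset (σ → ℝ))
    (hS : ∀ x ∈ S, ∀ j, eval x (F j) = q j)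
    (hdet : ∀ x ∈ S, (fderiv ℝ (fun (y : σ → ℝ) j => eval y (F j)) x).det ≠ 0) :
    S.card ≤ (D + 1) ^ Fintype.card σ := by
  classical
  set k := Fintype.card σ with hk
  choose g hg using exists_eval_eq_ite S
  let G : ℕ := S.sup fun z => (g z).totalDegree
  let s : ℕ := G + k
  let L : (S → restrictTotalDegree σ ℝ s) →ₗ[ℝ] MvPolynomial σ ℝ :=
    ∑ z : S, ((LinearMap.mulRight ℝ (g z)) ∘ₗ (aeval F).toLinearMap ∘ₗ
      (restrictTotalDegree σ ℝ s).subtype ∘ₗ LinearMap.proj z)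
  have hL : ∀ c, L c = ∑ z : S, aeval F (c z : MvPolynomial σ ℝ) * g z := by
    intro c
    simp only [L, LinearMap.sum_apply, LinearMap.comp_apply, LinearMap.proj_apply,
      Submodule.subtype_apply, AlgHom.toLinearMap_apply, LinearMap.mulRight_apply]
  have hLdeg : ∀ c, L c ∈ restrictTotalDegree σ ℝ (D * s + G) := by
    intro c
    rw [mem_restrictTotalDegree, hL]
    refine totalDegree_finsetSum_le fun z _ => (totalDegree_mul _ _).trans (add_le_add ?_ ?_)
    · exact (totalDegree_aeval_le hF _).trans
        (Nat.mul_le_mul_left _ ((mem_restrictTotalDegree _ _ _).1 (c z).2))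
    · exact Finset.le_sup (f := fun z => (g z).totalDegree) z.2
  have hinj : Function.Injective (L.codRestrict _ hLdeg) := by
    rw [← LinearMap.ker_eq_bot, LinearMap.ker_codRestrict, LinearMap.ker_eq_bot']
    intro c hc
    rw [hL] at hc
    have h := injective_sum_aeval_mul F q S hS hdet (fun z => g z)
      (fun z w => by rw [hg z w w.2]; simp only [Subtype.coe_inj]) (fun z => c z) hc
    funext z
    exact Subtype.ext (congrFun h z)
  have hle := LinearMap.finrank_le_finrank_of_injective hinj
  rw [Module.finrank_pi_fintype, finrank_restrictTotalDegree, finrank_restrictTotalDegree] at hle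
  simp only [Finset.sum_const, Finset.card_univ, Fintype.card_coe, smul_eq_mul, ← hk] at hle
  have h1 : S.card * (s + 1) ^ k ≤ ((D + 1) * (s + 1)) ^ k := by
    calc S.card * (s + 1) ^ k ≤ S.card * (s + k).descFactorial k := by
          gcongr
          have := Nat.pow_sub_le_descFactorial (s + k) k
          rwa [show s + k + 1 - k = s + 1 by omega] at this
      _ = S.card * (s + k).choose k * k.factorial := by
          rw [Nat.descFactorial_eq_factorial_mul_choose]; ring
      _ ≤ (D * s + G + k).choose k * k.factorial := Nat.mul_le_mul_right _ hle
      _ = (D * s + G + k).descFactorial k := by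
          rw [Nat.descFactorial_eq_factorial_mul_choose]; ring
      _ ≤ (D * s + G + k) ^ k := Nat.descFactorial_le_pow _ _
      _ ≤ ((D + 1) * (s + 1)) ^ k := by
          gcongr
          have : s = G + k := rfl
          nlinarith
  rw [mul_pow] at h1
  exact Nat.le_of_mul_le_mul_right h1 (by positivity)

end Calculus
end MvPolynomial

end

section

open MvPolynomial Filter Topology
open scoped Matrix

namespace MvPolynomial

variable {σ ι : Type*} [Fintype σ]

/-- More polynomials than variables satisfy a nontrivial algebraic relation. -/
theorem exists_aeval_eq_zero_of_card_lt [Fintype ι] (u : ι → MvPolynomial σ ℝ)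
    (h : Fintype.card σ < Fintype.card ι) :
    ∃ P : MvPolynomial ι ℝ, P ≠ 0 ∧ aeval u P = 0 := by
  by_contra! hP
  have hind : AlgebraicIndependent ℝ u := by
    rw [algebraicIndependent_iff]
    intro P h0
    by_contra hne
    exact hP P hne h0
  have := hind.lift_cardinalMk_le_trdeg
  rw [trdeg_of_isDomain] at this
  simp only [Cardinal.mk_fintype, Cardinal.lift_natCast, Nat.cast_le] at this
  omega

/-- There are arbitrarily small positive levels `c i` such that no point brings more of the
values `u i` close to their levels than there are variables. -/
theorem exists_generic_levels [Fintype ι] (u : ι → MvPolynomial σ ℝ) (b : ι → ℝ) (hb : ∀ i, 0 < b i) :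
    ∃ c : ι → ℝ, (∀ i, 0 < c i ∧ c i < b i) ∧ ∃ η > 0, (∀ i, η < c i) ∧
      ∀ (x : σ → ℝ) (A : Finset ι), (∀ i ∈ A, |eval x (u i) - c i| ≤ η) →
        A.card ≤ Fintype.card σ := by
  classical
  let T : Finset (Finset ι) := Finset.univ.powersetCard (Fintype.card σ + 1)
  have hP : ∀ I : T, ∃ P : MvPolynomial I.1 ℝ, P ≠ 0 ∧ aeval (fun i : I.1 => u i) P = 0 := by
    intro I
    refine exists_aeval_eq_zero_of_card_lt _ ?_
    rw [Fintype.card_coe, (Finset.mem_powersetCard.1 I.2).2]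
    exact Nat.lt_succ_self _
  choose P hP0 hPu using hP
  obtain ⟨c, hc, hcP⟩ : ∃ c ∈ Set.pi Set.univ fun i => Set.Ioo 0 (b i),
      eval c (∏ I : T, rename (Subtype.val : I.1 → ι) (P I)) ≠ 0 := by
    by_contra! h
    have h0 : ∏ I : T, rename (Subtype.val : I.1 → ι) (P I) = 0 :=
      funext_set _ (fun i => Set.Ioo_infinite (hb i)) fun x hx => by rw [h x hx, map_zero]
    obtain ⟨I, -, hI⟩ := Finset.prod_eq_zero_iff.1 h0
    exact hP0 I (rename_injective _ Subtype.val_injective (by rw [hI, map_zero]))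
  have hcP' : ∀ I : T, eval (fun i : I.1 => c i) (P I) ≠ 0 := by
    intro I
    rw [map_prod, Finset.prod_ne_zero_iff] at hcP
    have := hcP I (Finset.mem_univ _)
    rwa [eval_rename] at this
  have hη : ∀ I : T, ∀ᶠ η in 𝓝[>] (0 : ℝ), ∀ y : I.1 → ℝ, (∀ i, |y i - c i| ≤ η) →
      eval y (P I) ≠ 0 := by
    intro I
    obtain ⟨r, hr, hball⟩ := Metric.eventually_nhds_iff_ball.1
      ((continuous_eval (P I)).continuousAt.eventually_ne (hcP' I))
    filter_upwards [Ioo_mem_nhdsGT hr] with η hη y hy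
    refine hball y ?_
    rw [Metric.mem_ball]
    refine lt_of_le_of_lt ((dist_pi_le_iff hη.1.le).2 fun i => ?_) hη.2
    rw [Real.dist_eq]
    exact hy i
  have hηc : ∀ i, ∀ᶠ η in 𝓝[>] (0 : ℝ), η < c i := fun i =>
    eventually_nhdsWithin_of_eventually_nhds (eventually_lt_nhds (hc i trivial).1)
  obtain ⟨η, hη0, hηI, hηc⟩ := ((eventually_mem_nhdsWithin.and
    ((eventually_all.2 hη).and (eventually_all.2 hηc)))).exists
  refine ⟨c, fun i => hc i trivial, η, hη0, hηc, fun x A hA => ?_⟩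
  by_contra! hcard
  obtain ⟨I, hIA, hI⟩ := Finset.exists_subset_card_eq (Nat.succ_le_of_lt hcard)
  have hIT : I ∈ T := Finset.mem_powersetCard.2 ⟨Finset.subset_univ _, hI⟩
  refine hηI ⟨I, hIT⟩ (fun i => eval x (u i)) (fun i => hA i (hIA i.2)) ?_
  have h := comp_aeval_apply (f := fun i : I => u i) (aeval (R := ℝ) x) (P ⟨I, hIT⟩)
  rw [hPu ⟨I, hIT⟩, map_zero] at h
  simpa only [aeval_eq_eval] using h.symm

/-- The squared norm plus a penalty for the levels of the polynomials indexed by `A`. -/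
noncomputable def penalty (f : ι → MvPolynomial σ ℝ) (c : ι → ℝ) (M : ℕ) (A : Finset ι) :
    MvPolynomial σ ℝ :=
  ∑ j, X j ^ 2 + C (M : ℝ) * ∑ i ∈ A, (C (c i) - f i ^ 2) ^ 2

theorem totalDegree_penalty_le (f : ι → MvPolynomial σ ℝ) {d : ℕ} (hd : 1 ≤ d)
    (hf : ∀ i, (f i).totalDegree ≤ d) (c : ι → ℝ) (M : ℕ) (A : Finset ι) :
    (penalty f c M A).totalDegree ≤ 4 * d := by
  refine (totalDegree_add _ _).trans (max_le ?_ ?_)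
  · refine totalDegree_finsetSum_le fun j _ => (totalDegree_pow _ _).trans ?_
    rw [totalDegree_X]
    omega
  · refine (totalDegree_mul _ _).trans ?_
    rw [totalDegree_C, zero_add]
    refine totalDegree_finsetSum_le fun i _ => (totalDegree_pow _ _).trans ?_
    have h1 := totalDegree_sub (C (c i)) (f i ^ 2)
    have h2 := totalDegree_pow (f i) 2
    have h3 := hf i
    rw [totalDegree_C] at h1
    have : max 0 (f i ^ 2).totalDegree ≤ 2 * d := max_le (by omega) (by omega)
    omega

/-- Minimizing the penalized distance to `q` over the closed cell of `p` gives a critical point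
in the open cell of `p`. -/
theorem exists_critical_point_in_cell [Fintype ι] (f : ι → MvPolynomial σ ℝ) (c : ι → ℝ) (η : ℝ) (hη : 0 < η)
    (hηc : ∀ i, η < c i) (M : ℕ) (q p : σ → ℝ)
    (hp : ∀ i, c i < eval p (f i) ^ 2) (hM : ∑ j, (p j - q j) ^ 2 < M * η ^ 2) :
    ∃ (x : σ → ℝ) (A : Finset ι), (∀ i, 0 < eval p (f i) * eval x (f i)) ∧
      (∀ i ∈ A, |eval x (f i ^ 2) - c i| ≤ η) ∧
      ∀ j, eval x (pderiv j (penalty f c M A)) = 2 * q j := by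
  classical
  let h : (σ → ℝ) → ℝ := fun x =>
    ∑ j, (x j - q j) ^ 2 + M * ∑ i, max (c i - eval x (f i) ^ 2) 0 ^ 2
  have hcont : Continuous h := by
    have := fun i => continuous_eval (f i)
    fun_prop
  set R := ∑ j, (p j - q j) ^ 2 with hR
  have hR0 : 0 ≤ R := Finset.sum_nonneg fun _ _ => sq_nonneg _
  let K : Set (σ → ℝ) := Metric.closedBall q (R + 1) ∩ {x | ∀ i, 0 ≤ eval p (f i) * eval x (f i)}
  have hclosed : IsClosed {x : σ → ℝ | ∀ i, 0 ≤ eval p (f i) * eval x (f i)} := by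
    simp only [Set.ofPred_forall]
    exact isClosed_iInter fun i =>
      isClosed_le continuous_const (continuous_const.mul (continuous_eval (f i)))
  have hdist : ∀ x : σ → ℝ, ∑ j, (x j - q j) ^ 2 ≤ R → dist x q < R + 1 := by
    intro x hx
    rw [dist_pi_lt_iff (by linarith)]
    intro j
    rw [Real.dist_eq]
    have h1 : (x j - q j) ^ 2 ≤ R :=
      (Finset.single_le_sum (f := fun j => (x j - q j) ^ 2) (fun _ _ => sq_nonneg _)
        (Finset.mem_univ j)).trans hx
    refine abs_lt_of_sq_lt_sq ?_ (by linarith)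
    nlinarith
  have hpK : p ∈ K := ⟨(hdist p le_rfl).le, fun i => mul_self_nonneg _⟩
  obtain ⟨x, hxK, hxmin⟩ := ((isCompact_closedBall q (R + 1)).inter_right hclosed).exists_isMinOn
    ⟨p, hpK⟩ hcont.continuousOn
  have hhp : h p = R := by
    have : ∀ i, max (c i - eval p (f i) ^ 2) 0 = 0 := fun i => max_eq_right (by linarith [hp i])
    simp [h, this, hR]
  have hhx : h x ≤ R := hhp ▸ hxmin hpK
  have hpen0 : 0 ≤ ∑ i, max (c i - eval x (f i) ^ 2) 0 ^ 2 :=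
    Finset.sum_nonneg fun _ _ => sq_nonneg _
  have hsq0 : 0 ≤ ∑ j, (x j - q j) ^ 2 := Finset.sum_nonneg fun _ _ => sq_nonneg _
  have hM0 : (0 : ℝ) ≤ M := Nat.cast_nonneg M
  have hxq : ∑ j, (x j - q j) ^ 2 ≤ R := by
    have : 0 ≤ M * ∑ i, max (c i - eval x (f i) ^ 2) 0 ^ 2 := mul_nonneg hM0 hpen0
    simp only [h] at hhx
    linarith
  have hviol : ∀ i, c i - eval x (f i) ^ 2 < η := by
    intro i
    have h1 : max (c i - eval x (f i) ^ 2) 0 ^ 2 ≤ ∑ i, max (c i - eval x (f i) ^ 2) 0 ^ 2 :=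
      Finset.single_le_sum (f := fun i => max (c i - eval x (f i) ^ 2) 0 ^ 2)
        (fun _ _ => sq_nonneg _) (Finset.mem_univ i)
    have h2 : M * max (c i - eval x (f i) ^ 2) 0 ^ 2 < M * η ^ 2 := by
      have := mul_le_mul_of_nonneg_left h1 hM0
      simp only [h] at hhx
      linarith
    have h3 := lt_of_mul_lt_mul_left h2 hM0
    exact (le_max_left _ _).trans_lt (lt_of_pow_lt_pow_left₀ 2 hη.le h3)
  have hcell : ∀ i, 0 < eval p (f i) * eval x (f i) := by
    intro i
    refine lt_of_le_of_ne (hxK.2 i) (Ne.symm (mul_ne_zero ?_ ?_))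
    · intro h0
      have := hp i
      rw [h0] at this
      linarith [hηc i]
    · intro h0
      have := hviol i
      rw [h0] at this
      linarith [hηc i]
  let A : Finset ι := Finset.univ.filter fun i => eval x (f i) ^ 2 ≤ c i
  refine ⟨x, A, hcell, fun i hi => ?_, fun j => ?_⟩
  · rw [map_pow, abs_le]
    have := (Finset.mem_filter.1 hi).2
    constructor <;> linarith [hviol i]
  let Q : MvPolynomial σ ℝ := ∑ j, (X j - C (q j)) ^ 2 + C (M : ℝ) * ∑ i ∈ A, (C (c i) - f i ^ 2) ^ 2
  have hQ : ∀ y, eval y Q = ∑ j, (y j - q j) ^ 2 + M * ∑ i ∈ A, (c i - eval y (f i) ^ 2) ^ 2 := by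
    intro y
    simp [Q]
  have hmin : IsLocalMin (fun y => eval y Q) x := by
    have e1 : ∀ᶠ y in 𝓝 x, dist y q < R + 1 :=
      (continuous_id.dist continuous_const).continuousAt.eventually_lt_const (hdist x hxq)
    have e2 : ∀ i, ∀ᶠ y in 𝓝 x, 0 < eval p (f i) * eval y (f i) := fun i =>
      (continuous_const.mul (continuous_eval (f i))).continuousAt.eventually_const_lt (hcell i)
    have e3 : ∀ i, ∀ᶠ y in 𝓝 x, i ∉ A → c i < eval y (f i) ^ 2 := by
      intro i
      by_cases hi : i ∈ A
      · exact Eventually.of_forall fun _ h => absurd hi h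
      · have : c i < eval x (f i) ^ 2 := by simpa [A] using hi
        exact (((continuous_eval (f i)).pow 2).continuousAt.eventually_const_lt this).mono
          fun _ h _ => h
    filter_upwards [e1, eventually_all.2 e2, eventually_all.2 e3] with y hy1 hy2 hy3
    have hyK : y ∈ K := ⟨hy1.le, fun i => (hy2 i).le⟩
    have hxy : h x ≤ h y := hxmin hyK
    have hx : h x = eval x Q := by
      rw [hQ]
      simp only [h]
      congr 2
      rw [← Finset.sum_subset (Finset.subset_univ A)]
      · refine Finset.sum_congr rfl fun i hi => ?_
        rw [max_eq_left (sub_nonneg.2 (Finset.mem_filter.1 hi).2)]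
      · intro i _ hi
        have : c i < eval x (f i) ^ 2 := by simpa [A] using hi
        rw [max_eq_right (by linarith)]
        norm_num
    have hy : h y ≤ eval y Q := by
      rw [hQ]
      simp only [h]
      gcongr
      rw [← Finset.sum_subset (Finset.subset_univ A)]
      · refine Finset.sum_le_sum fun i _ => ?_
        rcases le_total (c i - eval y (f i) ^ 2) 0 with h0 | h0
        · rw [max_eq_right h0]
          nlinarith [sq_nonneg (c i - eval y (f i) ^ 2)]
        · rw [max_eq_left h0]
      · intro i _ hi
        rw [max_eq_right (by linarith [hy3 i hi])]
        norm_num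
    linarith
  have hderiv := hmin.hasFDerivAt_eq_zero (hasStrictFDerivAt_eval Q x).hasFDerivAt
  have hQj : eval x (pderiv j Q) = 0 := by
    have := congrArg (fun L : (σ → ℝ) →L[ℝ] ℝ => L (Pi.single j 1)) hderiv
    simpa [Pi.single_apply] using this
  have hdiff : pderiv j (penalty f c M A) = pderiv j Q + 2 * C (q j) := by
    have hX : ∀ k, pderiv j ((X k - C (q k)) ^ 2 : MvPolynomial σ ℝ) =
        pderiv j (X k ^ 2) - if k = j then 2 * C (q j) else 0 := by
      intro k
      by_cases hk : k = j
      · subst hk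
        simp [pderiv_X]
        ring
      · simp [pderiv_X, hk]
    simp only [penalty, Q, map_add, map_sum, hX, Finset.sum_sub_distrib]
    simp
    ring
  rw [hdiff, map_add, hQj, zero_add, map_mul, eval_C, map_ofNat]

/-- Warren's bound for the number of strict sign patterns. -/
theorem card_sign_patterns_le [Fintype ι] (f : ι → MvPolynomial σ ℝ) {d : ℕ} (hd : 1 ≤ d)
    (hf : ∀ i, (f i).totalDegree ≤ d) (S : Finset (σ → ℝ))
    (hS : ∀ p ∈ S, ∀ i, eval p (f i) ≠ 0)
    (hinj : ∀ p ∈ S, ∀ p' ∈ S, (∀ i, 0 < eval p (f i) * eval p' (f i)) → p = p') :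
    S.card ≤ (∑ j ∈ Finset.range (Fintype.card σ + 1), (Fintype.card ι).choose j) *
      (4 * d + 1) ^ Fintype.card σ := by
  classical
  rcases S.eq_empty_or_nonempty with rfl | hne
  · simp
  obtain ⟨c, hcb, η, hη, hηc, hgen⟩ := exists_generic_levels (fun i => f i ^ 2)
    (fun i => S.inf' hne fun p => eval p (f i) ^ 2) fun i => by
      rw [Finset.lt_inf'_iff]
      exact fun p hp => by have := hS p hp i; positivity
  have hcp : ∀ p ∈ S, ∀ i, c i < eval p (f i) ^ 2 := fun p hp i =>
    (hcb i).2.trans_le (Finset.inf'_le _ hp)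
  obtain ⟨q', hq'⟩ := (MeasureTheory.ae_all_iff.2 fun M : ℕ => MeasureTheory.ae_all_iff.2 fun A : Finset ι =>
    ae_det_fderiv_ne_zero fun j => pderiv j (penalty f c M A)).exists
  let q : σ → ℝ := fun j => q' j / 2
  let r : (σ → ℝ) → ℝ := fun p => ∑ j, (p j - q j) ^ 2
  obtain ⟨M, hM⟩ := exists_nat_gt (S.sup' hne r / η ^ 2)
  have hMp : ∀ p ∈ S, r p < M * η ^ 2 := by
    intro p hp
    rw [div_lt_iff₀ (by positivity)] at hM
    exact (Finset.le_sup' r hp).trans_lt hM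
  choose! x A hcell hA hcrit using fun p (hp : p ∈ S) =>
    exists_critical_point_in_cell f c η hη hηc M q p (hcp p hp) (hMp p hp)
  let T : Finset (Finset ι) :=
    (Finset.range (Fintype.card σ + 1)).biUnion fun j => Finset.univ.powersetCard j
  have hT : ∀ p ∈ S, A p ∈ T := by
    intro p hp
    have := hgen (x p) (A p) (hA p hp)
    simp only [T, Finset.mem_biUnion, Finset.mem_range, Finset.mem_powersetCard_univ,
      exists_eq_right']
    omega
  have hxinj : Set.InjOn x S := by
    intro p hp p' hp' hxx
    refine hinj p hp p' hp' fun i => ?_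
    have h1 := hcell p hp i
    have h2 := hcell p' hp' i
    rw [← hxx] at h2
    have h3 := mul_pos h1 h2
    have h4 : eval p (f i) * eval (x p) (f i) * (eval p' (f i) * eval (x p) (f i)) =
      eval p (f i) * eval p' (f i) * eval (x p) (f i) ^ 2 := by ring
    rw [h4] at h3
    exact pos_of_mul_pos_left h3 (sq_nonneg _)
  have hfib : ∀ B ∈ T, (S.filter fun p => A p = B).card ≤ (4 * d + 1) ^ Fintype.card σ := by
    intro B _
    rw [← Finset.card_image_of_injOn (f := x)
      (hxinj.mono (by exact_mod_cast Finset.filter_subset _ S))]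
    have hval : ∀ y ∈ (S.filter fun p => A p = B).image x, ∀ j,
        eval y (pderiv j (penalty f c M B)) = q' j := by
      intro y hy j
      obtain ⟨p, hp, rfl⟩ := Finset.mem_image.1 hy
      obtain ⟨hpS, rfl⟩ := Finset.mem_filter.1 hp
      rw [hcrit p hpS j]
      simp only [q]
      ring
    exact card_le_of_nondegenerate (fun j => pderiv j (penalty f c M B))
      (fun j => (totalDegree_pderiv_le _ _).trans (totalDegree_penalty_le f hd hf c M B)) q' _
      hval fun y hy => hq' M B y (hval y hy)
  refine (Finset.card_le_mul_card_image_of_maps_to hT _ hfib).trans ?_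
  rw [mul_comm]
  gcongr
  refine Finset.card_biUnion_le.trans (le_of_eq ?_)
  simp [Finset.card_powersetCard]

end MvPolynomial

end

/-- Twice the signed area of the triangle `a b c`. -/
def signedArea (a b c : Plane) : ℝ :=
  (b 0 - a 0) * (c 1 - a 1) - (c 0 - a 0) * (b 1 - a 1)

theorem orient_eq_sign_signedArea (a b c : Plane) :
    orient a b c = Real.sign (signedArea a b c) := by
  unfold orient signedArea
  congr 1
  rw [Matrix.det_fin_three]
  simp
  ring

theorem orient_eq_orient_iff (a b c a' b' c' : Plane) :
    orient a b c = orient a' b' c' ↔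
      SignType.sign (signedArea a b c) = SignType.sign (signedArea a' b' c') := by
  rw [orient_eq_sign_signedArea, orient_eq_sign_signedArea]
  rcases lt_trichotomy (signedArea a b c) 0 with h | h | h <;>
  rcases lt_trichotomy (signedArea a' b' c') 0 with h' | h' | h' <;>
  simp [Real.sign_of_neg, Real.sign_of_pos, h, h', sign_pos, sign_neg] <;> norm_num

theorem orient_ne_zero_iff (a b c : Plane) : orient a b c ≠ 0 ↔ signedArea a b c ≠ 0 := by
  rw [orient_eq_sign_signedArea, Ne, Real.sign_eq_zero_iff]

/-- Increasing triples of indices. -/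
abbrev IncTriple (n : ℕ) :=
  {t : Fin n × Fin n × Fin n // t.1 < t.2.1 ∧ t.2.1 < t.2.2}

theorem card_incTriple_le (n : ℕ) : Fintype.card (IncTriple n) ≤ n ^ 3 := by
  refine (Fintype.card_subtype_le _).trans (le_of_eq ?_)
  simp
  ring

/-- The sign pattern of an order type. -/
def orderTypePattern (n : ℕ) :
    Quot (fun p q : GPTuple n => OTIso p.1 q.1) → IncTriple n → SignType :=
  Quot.lift (fun p t => SignType.sign (signedArea (p.1 t.1.1) (p.1 t.1.2.1) (p.1 t.1.2.2)))
    fun _ _ h => funext fun t => (orient_eq_orient_iff _ _ _ _ _ _).1 (h _ _ _ t.2.1 t.2.2)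

theorem orderTypePattern_injective (n : ℕ) : Function.Injective (orderTypePattern n) := by
  intro a b
  induction a using Quot.ind with | mk p
  induction b using Quot.ind with | mk q
  intro h
  exact Quot.sound fun i j k hij hjk =>
    (orient_eq_orient_iff _ _ _ _ _ _).2 (congrFun h ⟨(i, j, k), hij, hjk⟩)

instance finite_orderTypes (n : ℕ) : Finite (Quot fun p q : GPTuple n => OTIso p.1 q.1) :=
  Finite.of_injective _ (orderTypePattern_injective n)

section UpperBound

open MvPolynomial

/-- The signed area of a triple of points as a polynomial in all coordinates. -/
def areaPoly {n : ℕ} (t : IncTriple n) : MvPolynomial (Fin n × Fin 2) ℝ :=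
  (X (t.1.2.1, 0) - X (t.1.1, 0)) * (X (t.1.2.2, 1) - X (t.1.1, 1)) -
    (X (t.1.2.2, 0) - X (t.1.1, 0)) * (X (t.1.2.1, 1) - X (t.1.1, 1))

theorem totalDegree_areaPoly_le {n : ℕ} (t : IncTriple n) : (areaPoly t).totalDegree ≤ 2 := by
  have hX : ∀ a b : Fin n × Fin 2, (X a - X b : MvPolynomial (Fin n × Fin 2) ℝ).totalDegree ≤ 1 := by
    intro a b
    refine (totalDegree_sub _ _).trans ?_
    simp
  have hmul : ∀ a b c d : Fin n × Fin 2,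
      ((X a - X b) * (X c - X d) : MvPolynomial (Fin n × Fin 2) ℝ).totalDegree ≤ 2 :=
    fun a b c d => (totalDegree_mul _ _).trans (add_le_add (hX a b) (hX c d))
  exact (totalDegree_sub _ _).trans (max_le (hmul _ _ _ _) (hmul _ _ _ _))

theorem eval_areaPoly {n : ℕ} (p : Fin n → Plane) (t : IncTriple n) :
    eval (fun a : Fin n × Fin 2 => p a.1 a.2) (areaPoly t) =
      signedArea (p t.1.1) (p t.1.2.1) (p t.1.2.2) := by
  simp [areaPoly, signedArea]

theorem tS_le_sum_choose (n : ℕ) :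
    tS n ≤ (∑ j ∈ Finset.range (2 * n + 1), (n ^ 3).choose j) * 9 ^ (2 * n) := by
  classical
  have := Fintype.ofFinite (Quot fun p q : GPTuple n => OTIso p.1 q.1)
  let r : (Quot fun p q : GPTuple n => OTIso p.1 q.1) → Fin n × Fin 2 → ℝ :=
    fun a x => a.out.1 x.1 x.2
  have heval : ∀ a t, eval (r a) (areaPoly t) =
      signedArea (a.out.1 t.1.1) (a.out.1 t.1.2.1) (a.out.1 t.1.2.2) :=
    fun a t => eval_areaPoly a.out.1 t
  have hne : ∀ a t, eval (r a) (areaPoly t) ≠ 0 := by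
    intro a t
    rw [heval, ← orient_ne_zero_iff]
    exact a.out.2.2 _ _ _ t.2.1.ne (t.2.1.trans t.2.2).ne t.2.2.ne
  have hinj : ∀ a b, (∀ t, 0 < eval (r a) (areaPoly t) * eval (r b) (areaPoly t)) → a = b := by
    intro a b h
    rw [← Quot.out_eq a, ← Quot.out_eq b]
    refine Quot.sound fun i j k hij hjk => (orient_eq_orient_iff _ _ _ _ _ _).2 ?_
    have := h ⟨(i, j, k), hij, hjk⟩
    rw [heval, heval] at this
    rcases mul_pos_iff.1 this with ⟨h1, h2⟩ | ⟨h1, h2⟩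
    · rw [sign_pos h1, sign_pos h2]
    · rw [sign_neg h1, sign_neg h2]
  have hrinj : Function.Injective r := fun a b hab => hinj a b fun t => by
    rw [hab]
    exact mul_self_pos.2 (hne b t)
  have h := card_sign_patterns_le (areaPoly (n := n)) one_le_two totalDegree_areaPoly_le
    (Finset.univ.image r) (by simpa using hne) (by
      simp only [Finset.mem_image, Finset.mem_univ, true_and, forall_exists_index,
        forall_apply_eq_imp_iff]
      exact fun a b h => congrArg r (hinj a b h))
  rw [Finset.card_image_of_injective _ hrinj, Finset.card_univ, ← Nat.card_eq_fintype_card,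
    Fintype.card_prod, Fintype.card_fin, Fintype.card_fin, mul_comm n 2] at h
  refine h.trans ?_
  gcongr
  · exact card_incTriple_le n
  · norm_num

theorem sum_choose_le_exp {N k : ℕ} (hk : 0 < k) (hkN : k ≤ N) :
    ((∑ j ∈ Finset.range (k + 1), N.choose j : ℕ) : ℝ) ≤ (N / k : ℝ) ^ k * Real.exp k := by
  have hk' : (0 : ℝ) < k := Nat.cast_pos.2 hk
  have h1 : (1 : ℝ) ≤ N / k := by
    rw [one_le_div hk']
    exact_mod_cast hkN
  push_cast
  calc (∑ j ∈ Finset.range (k + 1), (N.choose j : ℝ))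
      ≤ ∑ j ∈ Finset.range (k + 1), (N / k : ℝ) ^ k * ((k : ℝ) ^ j / j.factorial) := by
        refine Finset.sum_le_sum fun j hj => ?_
        have hj' : j ≤ k := Nat.lt_succ_iff.1 (Finset.mem_range.1 hj)
        calc (N.choose j : ℝ) ≤ (N : ℝ) ^ j / j.factorial := Nat.choose_le_pow_div j N
          _ = (N / k : ℝ) ^ j * ((k : ℝ) ^ j / j.factorial) := by
            rw [div_pow]
            field_simp
          _ ≤ _ := by gcongr
    _ = (N / k : ℝ) ^ k * ∑ j ∈ Finset.range (k + 1), (k : ℝ) ^ j / j.factorial := by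
        rw [Finset.mul_sum]
    _ ≤ _ := by
        gcongr
        exact Real.sum_le_exp_of_nonneg hk'.le _

theorem tS_le_pow {n : ℕ} (hn : 2 ≤ n) : (tS n : ℝ) ≤ (n : ℝ) ^ (4 * n) * 729 ^ n := by
  have hn0 : (0 : ℝ) < n := by positivity
  have hle : 2 * n ≤ n ^ 3 := by nlinarith [Nat.pow_le_pow_left hn 2]
  calc (tS n : ℝ)
      ≤ ((∑ j ∈ Finset.range (2 * n + 1), (n ^ 3).choose j : ℕ) : ℝ) * 9 ^ (2 * n) := by
        exact_mod_cast tS_le_sum_choose n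
    _ ≤ ((n ^ 3 : ℕ) / (2 * n : ℕ) : ℝ) ^ (2 * n) * Real.exp (2 * n : ℕ) * 9 ^ (2 * n) := by
        gcongr
        exact sum_choose_le_exp (by omega) hle
    _ ≤ ((n : ℝ) ^ 2) ^ (2 * n) * 3 ^ (2 * n) * 9 ^ (2 * n) := by
        gcongr
        · push_cast
          rw [div_le_iff₀ (by positivity)]
          nlinarith [pow_pos hn0 3]
        · rw [← Real.exp_one_pow]
          gcongr
          exact Real.exp_one_lt_three.le
    _ = (n : ℝ) ^ (4 * n) * 729 ^ n := by
        rw [mul_assoc, ← mul_pow, ← pow_mul, pow_mul (3 * 9 : ℝ)]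
        norm_num
        ring

theorem tS_upper {ε : ℝ} (hε : 0 < ε) :
    ∀ᶠ n : ℕ in Filter.atTop, (tS n : ℝ) ≤ (n : ℝ) ^ ((4 + ε) * (n : ℝ)) := by
  have hlim : Filter.Tendsto (fun n : ℕ => (n : ℝ) ^ ε) Filter.atTop Filter.atTop :=
    (tendsto_rpow_atTop hε).comp tendsto_natCast_atTop_atTop
  filter_upwards [hlim.eventually_ge_atTop 729, Filter.eventually_ge_atTop 2] with n h729 hn
  have hn0 : (0 : ℝ) < n := by positivity
  calc (tS n : ℝ) ≤ (n : ℝ) ^ (4 * n) * 729 ^ n := tS_le_pow hn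
    _ ≤ (n : ℝ) ^ (4 * n) * ((n : ℝ) ^ ε) ^ n := by gcongr
    _ = (n : ℝ) ^ ((4 + ε) * (n : ℝ)) := by
      rw [add_mul, Real.rpow_add hn0, Real.rpow_mul hn0.le ε, Real.rpow_natCast,
        ← Real.rpow_natCast (n : ℝ) (4 * n)]
      push_cast
      rfl

end UpperBound

section LowerBound

open Filter Topology

theorem eventually_quadratic_ne_zero {a b c : ℝ} (h : b ≠ 0 ∨ c ≠ 0) :
    ∀ᶠ δ in 𝓝[>] (0 : ℝ), a + b * δ + c * δ ^ 2 ≠ 0 := by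
  let P : Polynomial ℝ := .C a + .C b * .X + .C c * .X ^ 2
  have hP : P ≠ 0 := by
    intro h0
    have h1 : P.coeff 1 = 0 := by rw [h0]; simp
    have h2 : P.coeff 2 = 0 := by rw [h0]; simp
    simp [P, Polynomial.coeff_C, Polynomial.coeff_X_pow] at h1 h2
    exact h.elim (fun h => h h1) fun h => h h2
  have hfin : {δ | P.IsRoot δ ∧ δ ≠ 0}.Finite :=
    (Polynomial.finite_setOfPred_isRoot hP).subset fun δ h => h.1
  have hmem : {δ | P.IsRoot δ ∧ δ ≠ 0}ᶜ ∈ 𝓝 (0 : ℝ) :=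
    hfin.isClosed.isOpen_compl.mem_nhds (by simp)
  filter_upwards [nhdsWithin_le_nhds hmem, self_mem_nhdsWithin] with δ hδ hpos h0
  refine hδ ⟨?_, ne_of_gt hpos⟩
  simpa [P] using h0

/-- Every point tuple can be perturbed into general position without changing the nonzero
orientations. -/
theorem exists_genPos_perturbation {n : ℕ} (p : Fin n → Plane) :
    ∃ p' : GPTuple n, ∀ i j k, signedArea (p i) (p j) (p k) ≠ 0 →
      SignType.sign (signedArea (p'.1 i) (p'.1 j) (p'.1 k)) =
        SignType.sign (signedArea (p i) (p j) (p k)) := by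
  let P : ℝ → Fin n → Plane := fun δ i => !₂[p i 0 + δ * (i : ℕ), p i 1 + δ * ((i : ℕ) : ℝ) ^ 2]
  have hcast : ∀ {i j : Fin n}, i ≠ j → ((j : ℕ) : ℝ) - ((i : ℕ) : ℝ) ≠ 0 := by
    intro i j hij h
    exact hij (Fin.ext (by exact_mod_cast (sub_eq_zero.1 h).symm))
  have harea : ∀ i j k, ∃ b : ℝ, ∀ δ, signedArea (P δ i) (P δ j) (P δ k) =
      signedArea (p i) (p j) (p k) + b * δ +
        (((j : ℕ) : ℝ) - (i : ℕ)) * (((k : ℕ) : ℝ) - (i : ℕ)) * (((k : ℕ) : ℝ) - (j : ℕ)) *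
          δ ^ 2 := by
    intro i j k
    refine ⟨(p j 0 - p i 0) * (((k : ℕ) : ℝ) ^ 2 - ((i : ℕ) : ℝ) ^ 2) +
      (((j : ℕ) : ℝ) - (i : ℕ)) * (p k 1 - p i 1) -
      (p k 0 - p i 0) * (((j : ℕ) : ℝ) ^ 2 - ((i : ℕ) : ℝ) ^ 2) -
      (((k : ℕ) : ℝ) - (i : ℕ)) * (p j 1 - p i 1), fun δ => ?_⟩
    simp [P, signedArea]
    ring
  have e1 : ∀ i j, ∀ᶠ δ in 𝓝[>] (0 : ℝ), i ≠ j → P δ i 0 ≠ P δ j 0 := by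
    intro i j
    by_cases hij : i = j
    · exact Eventually.of_forall fun _ h => absurd hij h
    · filter_upwards [eventually_quadratic_ne_zero (a := p j 0 - p i 0) (c := 0)
        (Or.inl (hcast hij))] with δ hδ _ h
      refine hδ ?_
      simp only [P, Matrix.cons_val_zero] at h
      linarith
  have e2 : ∀ i j k, ∀ᶠ δ in 𝓝[>] (0 : ℝ), i ≠ j → i ≠ k → j ≠ k →
      signedArea (P δ i) (P δ j) (P δ k) ≠ 0 := by
    intro i j k
    obtain ⟨b, hb⟩ := harea i j k
    by_cases h : i ≠ j ∧ i ≠ k ∧ j ≠ k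
    · filter_upwards [eventually_quadratic_ne_zero (a := signedArea (p i) (p j) (p k)) (b := b)
        (Or.inr (mul_ne_zero (mul_ne_zero (hcast h.1) (hcast h.2.1)) (hcast h.2.2)))]
        with δ hδ _ _ _
      rw [hb]
      exact hδ
    · exact Eventually.of_forall fun _ h1 h2 h3 => absurd ⟨h1, h2, h3⟩ h
  have e3 : ∀ i j k, ∀ᶠ δ in 𝓝[>] (0 : ℝ), signedArea (p i) (p j) (p k) ≠ 0 →
      SignType.sign (signedArea (P δ i) (P δ j) (P δ k)) =
        SignType.sign (signedArea (p i) (p j) (p k)) := by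
    intro i j k
    obtain ⟨b, hb⟩ := harea i j k
    have hcont : Tendsto (fun δ => signedArea (P δ i) (P δ j) (P δ k)) (𝓝[>] 0)
        (𝓝 (signedArea (p i) (p j) (p k))) := by
      refine Tendsto.mono_left ?_ nhdsWithin_le_nhds
      simp only [hb]
      refine Continuous.tendsto' (by fun_prop) _ _ (by simp)
    rcases lt_trichotomy (signedArea (p i) (p j) (p k)) 0 with h | h | h
    · filter_upwards [hcont.eventually_lt_const h] with δ hδ _
      rw [sign_neg h, sign_neg hδ]
    · exact Eventually.of_forall fun _ h' => absurd h h'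
    · filter_upwards [hcont.eventually_const_lt h] with δ hδ _
      rw [sign_pos h, sign_pos hδ]
  obtain ⟨δ, h1, h2, h3⟩ := ((eventually_all.2 fun i => eventually_all.2 (e1 i)).and
    ((eventually_all.2 fun i => eventually_all.2 fun j => eventually_all.2 (e2 i j)).and
    (eventually_all.2 fun i => eventually_all.2 fun j => eventually_all.2 (e3 i j)))).exists
  refine ⟨⟨P δ, fun i j hij => ?_, fun i j k hij hik hjk => ?_⟩, h3⟩
  · by_contra hne
    exact h1 i j hne (by rw [hij])
  · exact (orient_ne_zero_iff _ _ _).2 (h2 i j k hij hik hjk)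

/-- Four groups of `s` points, whose connecting lines nearly form a grid of `s ^ 2` vertical and
`s ^ 2` horizontal lines, followed by points placed in prescribed cells of that grid. -/
def gridTuple (s : ℕ) {n : ℕ} (w : {k : Fin n // 4 * s ≤ k} → Fin (s ^ 2) × Fin (s ^ 2))
    (k : Fin n) : Plane :=
  if h : 4 * s ≤ k then !₂[((w ⟨k, h⟩).1 : ℝ) / 2 + 1 / 4, ((w ⟨k, h⟩).2 : ℝ) / 2 + 1 / 4]
  else if (k : ℕ) < s then !₂[(k : ℝ), -(2 * s ^ 4 + 1)]
  else if (k : ℕ) < 2 * s then !₂[(s : ℝ) * ((k - s : ℕ) : ℝ), 2 * s ^ 4 + 1]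
  else if (k : ℕ) < 3 * s then !₂[-(2 * s ^ 4 + 1), ((k - 2 * s : ℕ) : ℝ)]
  else !₂[2 * s ^ 4 + 1, (s : ℝ) * ((k - 3 * s : ℕ) : ℝ)]

/-- The line through `(i, -H)` and `(s * j, H)` passes between the grid columns `i + s * j - 1`
and `i + s * j`. -/
theorem grid_line_sign {s i j u v : ℕ} (hi : i < s) (hj : j < s) (hv : v < s ^ 2) :
    let D : ℝ := (s * j - i) * ((v / 2 + 1 / 4) - -(2 * s ^ 4 + 1)) -
      ((u / 2 + 1 / 4) - i) * ((2 * s ^ 4 + 1) - -(2 * s ^ 4 + 1))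
    (u < i + s * j → 0 < D) ∧ (i + s * j ≤ u → D < 0) := by
  intro D
  have hi' : (i : ℝ) ≤ s ^ 2 := by
    have : i ≤ s ^ 2 := by nlinarith
    exact_mod_cast this
  have hj' : (s * j : ℝ) ≤ s ^ 2 := by
    have : s * j ≤ s ^ 2 := by nlinarith
    exact_mod_cast this
  have hv' : (v : ℝ) + 1 ≤ s ^ 2 := by exact_mod_cast hv
  have hi0 : (0 : ℝ) ≤ i := Nat.cast_nonneg _
  have hj0 : (0 : ℝ) ≤ s * j := by positivity
  have hv0 : (0 : ℝ) ≤ v := Nat.cast_nonneg _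
  have hs4 : (s : ℝ) ^ 4 = s ^ 2 * s ^ 2 := by ring
  have hD : D = (2 * s ^ 4 + 1) * (i + s * j - u - 1 / 2) + (s * j - i) * (v / 2 + 1 / 4) := by
    simp only [D]
    ring
  have hy0 : (0 : ℝ) ≤ v / 2 + 1 / 4 := by positivity
  have hy : (v / 2 + 1 / 4 : ℝ) ≤ s ^ 2 := by linarith
  have hup : (s * j - i) * (v / 2 + 1 / 4 : ℝ) ≤ s ^ 4 := by
    rw [hs4]
    exact mul_le_mul (by linarith) hy hy0 (by positivity)
  have hlow : -(s : ℝ) ^ 4 ≤ (s * j - i) * (v / 2 + 1 / 4 : ℝ) := by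
    have : (i - s * j) * (v / 2 + 1 / 4 : ℝ) ≤ s ^ 4 := by
      rw [hs4]
      exact mul_le_mul (by linarith) hy hy0 (by positivity)
    linarith
  have hs0 : (0 : ℝ) ≤ s ^ 4 := by positivity
  constructor
  · intro h
    have h' : (u : ℝ) + 1 ≤ i + s * j := by exact_mod_cast h
    rw [hD]
    nlinarith
  · intro h
    have h' : (i : ℝ) + s * j ≤ u := by exact_mod_cast h
    rw [hD]
    nlinarith

theorem gridTuple_column_sign {s n : ℕ} (w : {k : Fin n // 4 * s ≤ k} → Fin (s ^ 2) × Fin (s ^ 2))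
    (k : {k : Fin n // 4 * s ≤ k}) {a b : Fin n} {i j : ℕ} (hi : i < s) (hj : j < s)
    (ha : (a : ℕ) = i) (hb : (b : ℕ) = s + j) :
    ((w k).1 < i + s * j →
      0 < signedArea (gridTuple s w a) (gridTuple s w b) (gridTuple s w k)) ∧
    (i + s * j ≤ (w k).1 →
      signedArea (gridTuple s w a) (gridTuple s w b) (gridTuple s w k) < 0) := by
  have h := grid_line_sign (u := (w k).1) hi hj (w k).2.2
  have ea : gridTuple s w a = !₂[(i : ℝ), -(2 * s ^ 4 + 1)] := by
    rw [gridTuple, dif_neg (by omega), if_pos (by omega), ha]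
  have eb : gridTuple s w b = !₂[(s : ℝ) * j, 2 * s ^ 4 + 1] := by
    rw [gridTuple, dif_neg (by omega), if_neg (by omega), if_pos (by omega), hb,
      Nat.add_sub_cancel_left]
  rw [ea, eb, gridTuple, dif_pos k.2]
  exact h

theorem gridTuple_row_sign {s n : ℕ} (w : {k : Fin n // 4 * s ≤ k} → Fin (s ^ 2) × Fin (s ^ 2))
    (k : {k : Fin n // 4 * s ≤ k}) {a b : Fin n} {i j : ℕ} (hi : i < s) (hj : j < s)
    (ha : (a : ℕ) = 2 * s + i) (hb : (b : ℕ) = 3 * s + j) :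
    ((w k).2 < i + s * j →
      signedArea (gridTuple s w a) (gridTuple s w b) (gridTuple s w k) < 0) ∧
    (i + s * j ≤ (w k).2 →
      0 < signedArea (gridTuple s w a) (gridTuple s w b) (gridTuple s w k)) := by
  have h := grid_line_sign (u := (w k).2) hi hj (w k).1.2
  have ea : gridTuple s w a = !₂[-(2 * (s : ℝ) ^ 4 + 1), (i : ℝ)] := by
    rw [gridTuple, dif_neg (by omega), if_neg (by omega), if_neg (by omega), if_pos (by omega), ha,
      Nat.add_sub_cancel_left]
  have eb : gridTuple s w b = !₂[2 * (s : ℝ) ^ 4 + 1, (s : ℝ) * j] := by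
    rw [gridTuple, dif_neg (by omega), if_neg (by omega), if_neg (by omega), if_neg (by omega), hb,
      Nat.add_sub_cancel_left]
  rw [ea, eb, gridTuple, dif_pos k.2, ← neg_pos (a := signedArea _ _ _),
    ← neg_lt_zero (a := signedArea _ _ _)]
  convert h using 3 <;>
  · simp [signedArea]
    ring

theorem gridTuple_separated {s n : ℕ}
    (w w' : {k : Fin n // 4 * s ≤ k} → Fin (s ^ 2) × Fin (s ^ 2)) (hw : w ≠ w') :
    ∃ i j k : Fin n, i < j ∧ j < k ∧
      signedArea (gridTuple s w i) (gridTuple s w j) (gridTuple s w k) *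
        signedArea (gridTuple s w' i) (gridTuple s w' j) (gridTuple s w' k) < 0 := by
  obtain ⟨k, hne⟩ := Function.ne_iff.1 hw
  have hk := k.2
  have hkn := k.1.2
  have hs : 0 < s := by
    rcases Nat.eq_zero_or_pos s with rfl | h
    · exact absurd (w k).1.2 (by simp)
    · exact h
  have hdec : ∀ m < s ^ 2, ∃ i j, i < s ∧ j < s ∧ i + s * j = m := fun m hm =>
    ⟨m % s, m / s, Nat.mod_lt _ hs, Nat.div_lt_of_lt_mul (by rwa [← sq]), Nat.mod_add_div m s⟩
  by_cases hu : (w k).1 = (w' k).1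
  · have hv : ((w k).2 : ℕ) ≠ (w' k).2 := fun h => hne (Prod.ext hu (Fin.ext h))
    obtain ⟨i, j, hi, hj, hm⟩ := hdec (max (w k).2 (w' k).2) (max_lt (w k).2.2 (w' k).2.2)
    refine ⟨⟨2 * s + i, by omega⟩, ⟨3 * s + j, by omega⟩, k, Fin.mk_lt_mk.2 (by omega),
      Fin.lt_def.2 (by dsimp only; omega), ?_⟩
    have h := gridTuple_row_sign w k (a := ⟨2 * s + i, by omega⟩) (b := ⟨3 * s + j, by omega⟩)
      hi hj rfl rfl
    have h' := gridTuple_row_sign w' k (a := ⟨2 * s + i, by omega⟩) (b := ⟨3 * s + j, by omega⟩)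
      hi hj rfl rfl
    rcases hv.lt_or_gt with hlt | hlt
    · exact mul_neg_of_neg_of_pos (h.1 (by omega)) (h'.2 (by omega))
    · exact mul_neg_of_pos_of_neg (h.2 (by omega)) (h'.1 (by omega))
  · have hu' : ((w k).1 : ℕ) ≠ (w' k).1 := fun h => hu (Fin.ext h)
    obtain ⟨i, j, hi, hj, hm⟩ := hdec (max (w k).1 (w' k).1) (max_lt (w k).1.2 (w' k).1.2)
    refine ⟨⟨i, by omega⟩, ⟨s + j, by omega⟩, k, Fin.mk_lt_mk.2 (by omega),
      Fin.lt_def.2 (by dsimp only; omega), ?_⟩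
    have h := gridTuple_column_sign w k (a := ⟨i, by omega⟩) (b := ⟨s + j, by omega⟩)
      hi hj rfl rfl
    have h' := gridTuple_column_sign w' k (a := ⟨i, by omega⟩) (b := ⟨s + j, by omega⟩)
      hi hj rfl rfl
    rcases hu'.lt_or_gt with hlt | hlt
    · exact mul_neg_of_pos_of_neg (h.1 (by omega)) (h'.2 (by omega))
    · exact mul_neg_of_neg_of_pos (h.2 (by omega)) (h'.1 (by omega))

theorem pow_le_tS {s n : ℕ} (hsn : 4 * s ≤ n) : (s ^ 4) ^ (n - 4 * s) ≤ tS n := by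
  classical
  choose P hP using fun w : {k : Fin n // 4 * s ≤ k} → Fin (s ^ 2) × Fin (s ^ 2) =>
    exists_genPos_perturbation (gridTuple s w)
  have hinj : Function.Injective fun w =>
      (Quot.mk _ (P w) : Quot fun p q : GPTuple n => OTIso p.1 q.1) := by
    intro w w' h
    by_contra hne
    obtain ⟨i, j, k, hij, hjk, hneg⟩ := gridTuple_separated w w' hne
    have h1 := congrFun (congrArg (orderTypePattern n) h) ⟨(i, j, k), hij, hjk⟩
    simp only [orderTypePattern] at h1
    rw [hP w i j k (left_ne_zero_of_mul hneg.ne), hP w' i j k (right_ne_zero_of_mul hneg.ne)] at h1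
    rcases mul_neg_iff.1 hneg with ⟨ha, hb⟩ | ⟨ha, hb⟩
    · rw [sign_pos ha, sign_neg hb] at h1
      exact absurd h1 (by decide)
    · rw [sign_neg ha, sign_pos hb] at h1
      exact absurd h1 (by decide)
  have hcard := Nat.card_le_card_of_injective _ hinj
  refine le_trans (le_of_eq ?_) hcard
  have hsub : Fintype.card {k : Fin n // 4 * s ≤ k} = n - 4 * s := by
    have h := Fintype.card_subtype_compl fun k : Fin n => (k : ℕ) < 4 * s
    simpa [Fintype.card_subtype, Fin.card_filter_val_lt, hsn] using h
  rw [Nat.card_eq_fintype_card, Fintype.card_fun, Fintype.card_prod, Fintype.card_fin, hsub]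
  ring

theorem tS_lower {ε : ℝ} (hε : 0 < ε) :
    ∀ᶠ n : ℕ in atTop, (n : ℝ) ^ ((4 - ε) * (n : ℝ)) ≤ (tS n : ℝ) := by
  rcases le_or_gt 4 ε with h4 | h4
  · filter_upwards [eventually_ge_atTop 4] with n hn
    have h1 : (1 : ℝ) ≤ tS n := by
      have := pow_le_tS (s := 1) (n := n) hn
      simp only [one_pow] at this
      exact_mod_cast this
    refine le_trans (Real.rpow_le_one_of_one_le_of_nonpos ?_ ?_) h1
    · exact_mod_cast (by omega : 1 ≤ n)
    · exact mul_nonpos_of_nonpos_of_nonneg (by linarith) (Nat.cast_nonneg n)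
  have hlim : Tendsto (fun n : ℕ => (n : ℝ) ^ (ε / 8)) atTop atTop :=
    (tendsto_rpow_atTop (by positivity)).comp tendsto_natCast_atTop_atTop
  filter_upwards [hlim.eventually_ge_atTop (64 / ε), eventually_ge_atTop 1,
    tendsto_natCast_atTop_atTop.eventually_ge_atTop (64 / ε)] with n hn h1 hn64
  have hn0 : (0 : ℝ) < n := by positivity
  have hn1 : (1 : ℝ) ≤ n := by exact_mod_cast h1
  set s := ⌊ε / 32 * n⌋₊ with hs
  have hsle : (s : ℝ) ≤ ε / 32 * n := Nat.floor_le (by positivity)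
  have hεn : 64 ≤ ε * n := by
    rw [div_le_iff₀ hε] at hn64
    linarith
  have hsge : ε / 64 * n ≤ s := by
    have := Nat.lt_floor_add_one (ε / 32 * n)
    rw [← hs] at this
    nlinarith
  have hs1 : (1 : ℝ) ≤ s := by linarith
  have hsn : 4 * s ≤ n := by
    have : (4 * s : ℝ) ≤ n := by nlinarith
    exact_mod_cast this
  have hpow : (n : ℝ) ^ (1 - ε / 8) ≤ s := by
    rw [Real.rpow_sub hn0, Real.rpow_one, div_le_iff₀ (by positivity)]
    rw [div_le_iff₀ hε] at hn
    nlinarith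
  calc (n : ℝ) ^ ((4 - ε) * (n : ℝ)) ≤ (n : ℝ) ^ ((1 - ε / 8) * ((4 - ε / 2) * n)) := by
        refine Real.rpow_le_rpow_of_exponent_le hn1 ?_
        nlinarith [mul_pos hε (mul_pos hε hn0)]
    _ = ((n : ℝ) ^ (1 - ε / 8)) ^ ((4 - ε / 2) * n) := Real.rpow_mul hn0.le _ _
    _ ≤ (s : ℝ) ^ ((4 - ε / 2) * n) :=
        Real.rpow_le_rpow (by positivity) hpow (mul_nonneg (by linarith) hn0.le)
    _ ≤ (s : ℝ) ^ ((4 * (n - 4 * s) : ℕ) : ℝ) := by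
        refine Real.rpow_le_rpow_of_exponent_le hs1 ?_
        push_cast [Nat.cast_sub hsn]
        linarith
    _ = (((s ^ 4) ^ (n - 4 * s) : ℕ) : ℝ) := by
        rw [Real.rpow_natCast, pow_mul]
        push_cast
        rfl
    _ ≤ tS n := by exact_mod_cast pow_le_tS hsn

end LowerBound

/-- Alon's estimate: `t_s(n,2) = n^{(4+o(1))n}`, i.e. for every `ε > 0` and all
sufficiently large `n`, `n^{(4-ε)n} ≤ t_s(n,2) ≤ n^{(4+ε)n}`. -/
theorem tS_asymptotics (ε : ℝ) (hε : 0 < ε) :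
    ∃ N : ℕ, ∀ n : ℕ, N ≤ n →
      (n : ℝ) ^ ((4 - ε) * (n : ℝ)) ≤ (tS n : ℝ) ∧
      (tS n : ℝ) ≤ (n : ℝ) ^ ((4 + ε) * (n : ℝ)) := by
  obtain ⟨N, hN⟩ := Filter.eventually_atTop.1 ((tS_lower hε).and (tS_upper hε))
  exact ⟨N, hN⟩
end
end

section
/- Let G be a finite simple graph and let π : V(G) → P ⊆ ℝ² be a straight-line embedding of G on a finite point set P. Then there exists ε > 0 such that for every choice of points (x_p)_{p ∈ P} with ‖x_p − p‖₂ < ε for all p ∈ P, the map π' : V(G) → ℝ² defined by π'(v) := x_{π(v)} is a straight-line embedding of G (onto the point set {x_p : p ∈ P}). -/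
noncomputable section

/-- Disjointness of two segments is an open condition on their endpoints. -/
theorem isOpen_setOf_disjoint_segment {X E : Type*} [TopologicalSpace X]
    [NormedAddCommGroup E] [NormedSpace ℝ E] {a b c d : X → E} (ha : Continuous a)
    (hb : Continuous b) (hc : Continuous c) (hd : Continuous d) :
    IsOpen {x | Disjoint (segment ℝ (a x) (b x)) (segment ℝ (c x) (d x))} := by
  let Z : Set ((unitInterval × unitInterval) × X) :=
    {q | AffineMap.lineMap (a q.2) (b q.2) (q.1.1 : ℝ) =
      AffineMap.lineMap (c q.2) (d q.2) (q.1.2 : ℝ)}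
  have hZ : IsClosed Z := by
    refine isClosed_eq ?_ ?_ <;> simp only [AffineMap.lineMap_apply_module] <;> fun_prop
  have himage := isClosedMap_snd_of_compactSpace Z hZ
  rw [← isClosed_compl_iff]
  convert himage using 1
  ext x
  simp only [Set.mem_compl_iff, Set.mem_ofPred_eq, Set.not_disjoint_iff,
    segment_eq_image_lineMap]
  constructor
  · rintro ⟨z, ⟨s, hs, hsz⟩, t, ht, htz⟩
    exact ⟨((⟨s, hs⟩, ⟨t, ht⟩), x), hsz.trans htz.symm, rfl⟩
  · rintro ⟨⟨⟨s, t⟩, y⟩, h, rfl⟩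
    exact ⟨_, ⟨s, s.2, rfl⟩, t, t.2, h.symm⟩

/-- Not lying on a segment is an open condition on the point and the endpoints. -/
theorem isOpen_setOf_notMem_segment {X E : Type*} [TopologicalSpace X]
    [NormedAddCommGroup E] [NormedSpace ℝ E] {a b c : X → E} (ha : Continuous a)
    (hb : Continuous b) (hc : Continuous c) :
    IsOpen {x | c x ∉ segment ℝ (a x) (b x)} := by
  simpa [segment_same] using isOpen_setOf_disjoint_segment ha hb hc hc

/-- Two segments with a common endpoint, neither of which contains the other endpoint of the
other one, meet only in the common endpoint. -/
theorem segment_inter_segment_subset_singleton {E : Type*} [AddCommGroup E] [Module ℝ E]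
    {a b c : E} (hc : c ∉ segment ℝ a b) (hb : b ∉ segment ℝ a c) :
    segment ℝ a b ∩ segment ℝ a c ⊆ {a} := by
  have key : ∀ {s t : ℝ} {b c : E}, 0 ≤ s → 0 < t → s ≤ t → s • (b - a) = t • (c - a) →
      c ∈ segment ℝ a b := by
    intro s t b c hs ht hst h
    rw [segment_eq_image']
    refine ⟨s / t, ⟨by positivity, (div_le_one ht).2 hst⟩, ?_⟩
    have h' : (s / t) • (b - a) = c - a := by
      rw [div_eq_inv_mul, mul_smul, h, inv_smul_smul₀ ht.ne']
    simp [h']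
  rw [segment_eq_image', segment_eq_image']
  rintro z ⟨⟨s, ⟨hs, -⟩, rfl⟩, t, ⟨ht, -⟩, h⟩
  have h' : t • (c - a) = s • (b - a) := add_left_cancel h
  rcases hs.eq_or_lt with rfl | hs0
  · simp
  rcases le_total s t with hst | hst
  · exact absurd (key hs (hs0.trans_le hst) hst h'.symm) hc
  · exact absurd (key ht hs0 hst h') hb

/-- A map is a straight-line embedding iff it is injective, no vertex lies on the closed segment
of a non-incident edge, and the segments of vertex-disjoint edges are disjoint. -/
theorem isSLEmbedding_iff {V : Type*} {G : SimpleGraph V} {π : V → Plane} :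
    IsSLEmbedding G π ↔
      (∀ u v, u ≠ v → π u ≠ π v) ∧
      (∀ u v w, G.Adj u v → w ≠ u → w ≠ v → π w ∉ segment ℝ (π u) (π v)) ∧
      (∀ u v x y, G.Adj u v → G.Adj x y → Disjoint ({u, v} : Set V) {x, y} →
        Disjoint (segment ℝ (π u) (π v)) (segment ℝ (π x) (π y))) := by
  constructor
  · rintro ⟨hinj, hinter, hopen⟩
    refine ⟨fun u v => hinj.ne, fun u v w huv hwu hwv hw => ?_, fun u v x y huv hxy hdisj => ?_⟩
    · exact hopen u v w huv hwu hwv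
        (mem_openSegment_of_ne_left_right (hinj.ne hwu.symm) (hinj.ne hwv.symm) hw)
    · have hne : s(u, v) ≠ s(x, y) := by
        intro h
        have hu : u ∈ s(x, y) := h ▸ Sym2.mem_mk_left u v
        exact Set.disjoint_left.1 hdisj (Set.mem_insert u {v}) (by simpa using hu)
      rw [Set.disjoint_iff_inter_eq_empty, ← Set.subset_empty_iff]
      simpa [hdisj.inter_eq] using hinter u v x y huv hxy hne
  · rintro ⟨hinj, hvertex, hdisj⟩
    have hshare : ∀ u v y, G.Adj u v → G.Adj u y → v ≠ y →
        segment ℝ (π u) (π v) ∩ segment ℝ (π u) (π y) ⊆ {π u} := fun u v y huv huy hvy =>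
      segment_inter_segment_subset_singleton (hvertex u v y huv huy.ne' hvy.symm)
        (hvertex u y v huy huv.ne' hvy)
    refine ⟨fun u v h => not_imp_not.1 (hinj u v) h, fun u v x y huv hxy hne z hz => ?_,
      fun u v w huv hwu hwv hw => hvertex u v w huv hwu hwv (openSegment_subset_segment _ _ _ hw)⟩
    by_cases hux : u = x
    · subst hux
      have hvy : v ≠ y := by rintro rfl; exact hne rfl
      exact ⟨u, by simp, (hshare u v y huv hxy hvy hz).symm⟩
    by_cases huy : u = y
    · subst huy
      have hvx : v ≠ x := by rintro rfl; exact hne Sym2.eq_swap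
      rw [segment_symm ℝ (π x)] at hz
      exact ⟨u, by simp, (hshare u v x huv hxy.symm hvx hz).symm⟩
    by_cases hvx : v = x
    · subst hvx
      rw [segment_symm ℝ (π u)] at hz
      exact ⟨v, by simp, (hshare v u y huv.symm hxy huy hz).symm⟩
    by_cases hvy : v = y
    · subst hvy
      rw [segment_symm ℝ (π u), segment_symm ℝ (π x)] at hz
      exact ⟨v, by simp, (hshare v u x huv.symm hxy.symm hux hz).symm⟩
    · have hends : Disjoint ({u, v} : Set V) {x, y} := by
        simp [hux, huy, hvx, hvy, eq_comm]
      exact absurd hz.2 (Set.disjoint_left.1 (hdisj u v x y huv hxy hends) hz.1)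

/-- The straight-line embeddings of a finite graph form an open set of maps. -/
theorem isOpen_setOf_isSLEmbedding {V : Type*} [Finite V] (G : SimpleGraph V) :
    IsOpen {π : V → Plane | IsSLEmbedding G π} := by
  simp only [isSLEmbedding_iff, Set.ofPred_and, Set.ofPred_forall]
  refine .inter ?_ (.inter ?_ ?_)
  · exact isOpen_iInter_of_finite fun u => isOpen_iInter_of_finite fun v =>
      isOpen_iInter_of_finite fun _ => isOpen_ne_fun (continuous_apply u) (continuous_apply v)
  · exact isOpen_iInter_of_finite fun u => isOpen_iInter_of_finite fun v =>
      isOpen_iInter_of_finite fun w => isOpen_iInter_of_finite fun _ =>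
      isOpen_iInter_of_finite fun _ => isOpen_iInter_of_finite fun _ =>
      isOpen_setOf_notMem_segment (continuous_apply u) (continuous_apply v) (continuous_apply w)
  · exact isOpen_iInter_of_finite fun u => isOpen_iInter_of_finite fun v =>
      isOpen_iInter_of_finite fun x => isOpen_iInter_of_finite fun y =>
      isOpen_iInter_of_finite fun _ => isOpen_iInter_of_finite fun _ =>
      isOpen_iInter_of_finite fun _ => isOpen_setOf_disjoint_segment (continuous_apply u)
        (continuous_apply v) (continuous_apply x) (continuous_apply y)

/-- Stability of straight-line embeddings under small perturbations: if `π` is a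
straight-line embedding of `G` onto `P`, there is `ε > 0` such that moving every point
of `P` by less than `ε` still yields a straight-line embedding of `G`, onto the
perturbed point set. -/
theorem slEmbedding_stable_under_perturbation (V : Type) [Fintype V] (G : SimpleGraph V)
    (P : Set Plane) (π : V → Plane) (hπ : IsSLEmbedding G π) (hrange : Set.range π = P) :
    ∃ ε : ℝ, 0 < ε ∧ ∀ x : Plane → Plane, (∀ p ∈ P, ‖x p - p‖ < ε) →
      IsSLEmbedding G (fun v => x (π v)) ∧
      Set.range (fun v => x (π v)) = x '' P := by
  subst hrange
  obtain ⟨ε, hε, hball⟩ := Metric.isOpen_iff.1 (isOpen_setOf_isSLEmbedding G) π hπ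
  refine ⟨ε, hε, fun x hx => ⟨hball ?_, Set.range_comp x π⟩⟩
  rw [Metric.mem_ball, dist_pi_lt_iff hε]
  intro v
  rw [dist_eq_norm]
  exact hx _ (Set.mem_range_self v)
end
end
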